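/- arXiv:1111.5049 — 4 statements merged into one kernel-verified Lean document; each statement's English description precedes it below -/
import Mathlib

section
/- For all natural numbers r ≥ 0 and a ≥ 0, the signed sum over all permutations σ of {1,…,r} of the products of factorials, namely ∑_{σ ∈ S_r} sgn(σ) · ∏_{i=1}^{r} (i + σ(i) + a − 1)!, equals ∏_{i=1}^{r} (i−1)! · (i+a)!. -/
open Matrix in
lemma det_vandermonde_natCast_eq_prod_factorial (R : Type*) [CommRing R] (r : ℕ) :
    (vandermonde fun i : Fin r ↦ (i : R)).det = ∏ i : Fin r, (Nat.factorial (i : ℕ) : R) := by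
  cases r with
  | zero => simp
  | succ n =>
    rw [det_vandermonde_id_eq_superFactorial,
      Fin.prod_univ_eq_prod_range (fun i ↦ (Nat.factorial i : R)), ← Nat.cast_prod,
      Nat.prod_range_succ_factorial]

open Matrix in
/-- The Hankel determinant of the shifted factorials `b!, (b+1)!, …`. -/
lemma det_hankel_factorial (r b : ℕ) :
    (of fun i j : Fin r ↦ (Nat.factorial ((i : ℕ) + b + (j : ℕ)) : ℤ)).det =
      (∏ i : Fin r, (Nat.factorial ((i : ℕ) + b) : ℤ)) *
        ∏ i : Fin r, (Nat.factorial (i : ℕ) : ℤ) := by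
  have h := det_eval_matrixOfPolynomials_eq_det_vandermonde
    (fun i : Fin r ↦ (i : ℤ) + ((b : ℤ) + 1)) (fun j ↦ ascPochhammer ℤ j)
    (fun j ↦ ascPochhammer_natDegree (S := ℤ) j) (fun j ↦ monic_ascPochhammer ℤ j)
  rw [det_vandermonde_add, det_vandermonde_natCast_eq_prod_factorial] at h
  rw [h, ← det_mul_column]
  congr! 4 with i j
  have := factorial_mul_ascPochhammer ℤ ((i : ℕ) + b) j
  push_cast at this
  rw [of_apply, ← this, add_assoc]

/-- For all natural numbers `r, a`, the signed sum over all permutations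
`σ` of `{1,…,r}` of `∏_{i=1}^{r} (i + σ(i) + a − 1)!` equals `∏_{i=1}^{r} (i−1)!(i+a)!`.
Here `i` ranges over `Fin r`, representing the index `i+1 ∈ {1,…,r}`, so
`i + σ(i) + a − 1` becomes `(i+1) + (σ(i)+1) + a − 1 = i + σ(i) + a + 1`. -/
theorem signed_factorial_sum (r a : ℕ) :
    ∑ σ : Equiv.Perm (Fin r), (Equiv.Perm.sign σ : ℤ) *
      ∏ i : Fin r, (Nat.factorial ((i : ℕ) + (σ i : ℕ) + a + 1) : ℤ)
    = ∏ i : Fin r, (Nat.factorial (i : ℕ) : ℤ) *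
        (Nat.factorial ((i : ℕ) + 1 + a) : ℤ) := by
  rw [Finset.prod_mul_distrib, mul_comm]
  have h := det_hankel_factorial r (a + 1)
  rw [← Matrix.det_transpose, Matrix.det_apply'] at h
  simpa only [Matrix.transpose_apply, Matrix.of_apply, Int.cast_id,
    add_assoc, add_comm, add_left_comm] using h
end

section
/- Fix natural numbers r ≥ 0 and a ≥ 0. Define r×r matrices over ℚ: L_r(a) with entries (L_r(a))_{ij} = ((i+a)!/(j+a)!) · C(i−1, j−1), and U_r(a) with entries (U_r(a))_{ij} = (i−1)! · (j+a)! · C(j−1, i−1), for 1 ≤ i, j ≤ r, where C(·,·) is the binomial coefficient (so C(i−1,j−1) = 0 when j > i and C(j−1,i−1) = 0 when i > j). Then: (a) L_r(a) is lower triangular with all diagonal entries equal to 1; (b) U_r(a) is upper triangular with diagonal entries (U_r(a))_{ii} = (i−1)!(i+a)!; and (c) the matrix product satisfies (L_r(a) · U_r(a))_{ij} = (i+j+a−1)! for all 1 ≤ i, j ≤ r. In particular, L_r(a)·U_r(a) equals the Hankel matrix A_r(a) with entries (i+j+a−1)!. -/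
/-- Vandermonde's identity, multiplied by factorials to give a factorial in closed form. -/
theorem sum_range_factorial_div_mul_choose (i j b : ℕ) :
    ∑ k ∈ Finset.range (j + 1),
      (((i + b).factorial : ℚ) / (k + b).factorial * i.choose k) *
        (k.factorial * (j + b).factorial * j.choose k) = (i + j + b).factorial := by
  have hvand : ((i + (j + b)).choose j : ℚ) =
      ∑ k ∈ Finset.range (j + 1), (i.choose k : ℚ) * (j + b).choose (j - k) := by
    rw [Nat.add_choose_eq, Finset.Nat.sum_antidiagonal_eq_sum_range_succ_mk]
    push_cast
    rfl
  have hfact : ((i + j + b).factorial : ℚ) =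
      (i + b).factorial * j.factorial * (i + (j + b)).choose j := by
    have h := Nat.choose_mul_factorial_mul_factorial (n := i + (j + b)) (k := j) (by omega)
    rw [show i + (j + b) - j = i + b by omega] at h
    rw [show i + j + b = i + (j + b) by omega, ← h]
    push_cast
    ring
  rw [hfact, hvand, Finset.mul_sum]
  refine Finset.sum_congr rfl fun k hk => ?_
  have hkj : k ≤ j := Nat.lt_succ_iff.mp (Finset.mem_range.mp hk)
  have h₁ := Nat.choose_mul_factorial_mul_factorial hkj
  have h₂ := Nat.choose_mul_factorial_mul_factorial (n := j + b) (k := j - k) (by omega)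
  rw [show j + b - (j - k) = k + b by omega] at h₂
  rw [← h₁, ← h₂]
  have hne : ((k + b).factorial : ℚ) ≠ 0 := mod_cast (k + b).factorial_ne_zero
  push_cast
  field_simp

/-- The LU-decomposition of the Hankel matrix `A_r(a)` with entries
`(i+j+a−1)!`.  Indices `i j : Fin r` represent `i+1, j+1 ∈ {1,…,r}`, so e.g. the
entry `((i+a)!/(j+a)!)·C(i−1,j−1)` becomes `((i+1+a)!/(j+1+a)!)·C(i,j)`. -/
theorem hankel_LU_decomposition (r a : ℕ) (L U : Matrix (Fin r) (Fin r) ℚ)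
    (hL : ∀ i j : Fin r,
      L i j = (Nat.factorial ((i : ℕ) + 1 + a) : ℚ) / (Nat.factorial ((j : ℕ) + 1 + a) : ℚ) *
        (Nat.choose (i : ℕ) (j : ℕ) : ℚ))
    (hU : ∀ i j : Fin r,
      U i j = (Nat.factorial (i : ℕ) : ℚ) * (Nat.factorial ((j : ℕ) + 1 + a) : ℚ) *
        (Nat.choose (j : ℕ) (i : ℕ) : ℚ)) :
    (∀ i j : Fin r, (i : ℕ) < (j : ℕ) → L i j = 0) ∧
    (∀ i : Fin r, L i i = 1) ∧
    (∀ i j : Fin r, (j : ℕ) < (i : ℕ) → U i j = 0) ∧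
    (∀ i : Fin r,
      U i i = (Nat.factorial (i : ℕ) : ℚ) * (Nat.factorial ((i : ℕ) + 1 + a) : ℚ)) ∧
    (∀ i j : Fin r,
      (L * U) i j = (Nat.factorial ((i : ℕ) + (j : ℕ) + a + 1) : ℚ)) := by
  refine ⟨fun i j hij => ?_, fun i => ?_, fun i j hij => ?_, fun i => ?_, fun i j => ?_⟩
  · simp [hL, Nat.choose_eq_zero_of_lt hij]
  · have hne : (((i : ℕ) + 1 + a).factorial : ℚ) ≠ 0 := mod_cast Nat.factorial_ne_zero _
    simp [hL, hne]
  · simp [hU, Nat.choose_eq_zero_of_lt hij]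
  · simp [hU]
  · have h := sum_range_factorial_div_mul_choose i j (1 + a)
    simp only [← add_assoc] at h
    rw [show (i : ℕ) + j + a + 1 = i + j + 1 + a by omega, ← h, Matrix.mul_apply]
    simp only [hL, hU]
    rw [Fin.sum_univ_eq_sum_range (fun k =>
      (((i : ℕ) + 1 + a).factorial : ℚ) / (k + 1 + a).factorial * (i : ℕ).choose k *
        (k.factorial * ((j : ℕ) + 1 + a).factorial * (j : ℕ).choose k)) r]
    symm
    refine Finset.sum_subset (Finset.range_mono j.isLt) fun k _ hk => ?_
    have hjk : (j : ℕ) < k := by simpa using hk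
    simp [Nat.choose_eq_zero_of_lt hjk]
end

section
/- Let n ∈ ℝ be such that 4n is an odd integer and n ≥ −3/4, and set N = 4(n+1) and K = −2(n+1)(4n+1)/(2n+1) (note 2n + 1 ≠ 0). Then: (a) N = 2·Δ_{n,2} where Δ_{n,ℓ} = nℓ + ℓ²/2; (b) (N−1)·K/N + N − 2 = 1/(2(2n+1)); (c) K + N = 2(n+1)/(2n+1) ≠ 0; and (d) the Feigin–Semikhatov central charge C(N,K) = −((K+N)(N−1) − N)·((K+N)(N−2)·N − N² + 1)/(K+N) equals −1. -/
/-- The conformal dimension `Δ_{n,ℓ} = n·ℓ + ℓ²/2` (real parameters). -/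
noncomputable def Delta (n ℓ : ℝ) : ℝ := n * ℓ + ℓ ^ 2 / 2

/-- The Feigin–Semikhatov central charge
`C(N,K) = −((K+N)(N−1) − N)·((K+N)(N−2)·N − N² + 1)/(K+N)`. -/
noncomputable def FScharge (N K : ℝ) : ℝ :=
  -(((K + N) * (N - 1) - N) * ((K + N) * (N - 2) * N - N ^ 2 + 1)) / (K + N)

/-- For `n ∈ ℝ` such that `4n` is an odd integer and `n ≥ −3/4`, with
`N = 4(n+1)` and `K = −2(n+1)(4n+1)/(2n+1)`: (a) `N = 2Δ_{n,2}`;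
(b) `(N−1)K/N + N − 2 = 1/(2(2n+1))`; (c) `K + N = 2(n+1)/(2n+1) ≠ 0`;
(d) the central charge `C(N,K)` is `−1`. -/
theorem WN2_subalgebra_level_ell_two (n : ℝ)
    (hodd : ∃ k : ℤ, Odd k ∧ 4 * n = (k : ℝ)) (hn : -3/4 ≤ n) :
    2 * n + 1 ≠ 0 ∧
    (let N : ℝ := 4 * (n + 1)
     let K : ℝ := -2 * (n + 1) * (4 * n + 1) / (2 * n + 1)
     N = 2 * Delta n 2 ∧
     (N - 1) * K / N + N - 2 = 1 / (2 * (2 * n + 1)) ∧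
     K + N = 2 * (n + 1) / (2 * n + 1) ∧
     K + N ≠ 0 ∧
     FScharge N K = -1) := by
  have h1 : 2 * n + 1 ≠ 0 := by
    intro h
    obtain ⟨k, hk, hk'⟩ := hodd
    have hk2 : k = -2 := by
      have : (k : ℝ) = -2 := by linarith
      exact_mod_cast this
    subst hk2
    exact absurd hk (by decide)
  have h2 : n + 1 ≠ 0 := by
    intro h
    linarith
  refine ⟨h1, ?_⟩
  intro N K
  have hKN : K + N = 2 * (n + 1) / (2 * n + 1) := by
    simp only [N, K]
    field_simp
    ring
  have hne : K + N ≠ 0 := by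
    rw [hKN]
    exact div_ne_zero (mul_ne_zero two_ne_zero h2) h1
  have hfirst : (K + N) * (N - 1) - N = K + N := by
    rw [hKN]
    simp only [N]
    field_simp
    ring
  have hsecond : (K + N) * (N - 2) = N := by
    rw [hKN]
    simp only [N]
    field_simp
    ring
  refine ⟨?_, ?_, hKN, hne, ?_⟩
  · simp only [N, Delta]
    ring
  · have hKdivN : K / N = -(4 * n + 1) / (2 * (2 * n + 1)) := by
      simp only [N, K]
      rw [div_div, div_eq_div_iff (by positivity) (by positivity)]
      ring
    rw [mul_div_assoc, hKdivN]
    simp only [N]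
    linear_combination -(2 * (2 * n + 1)) * mul_inv_cancel₀ (mul_ne_zero (two_ne_zero (α := ℝ)) h1)
  · rw [FScharge, hfirst, hsecond, div_eq_iff hne]
    ring
end

section
/- Let R be the free abelian group with basis consisting of symbols A_n for n ∈ ℝ, T_{n,e} for n ∈ ℝ and e ∈ ℝ with e ≠ 0, and P_n for n ∈ ℝ. Define a ℤ-bilinear multiplication on R by: A_n·A_{n'} = A_{n+n'}; A_n·T_{n',e'} = T_{n+n',e'}; A_n·P_{n'} = P_{n+n'}; T_{n,e}·T_{n',e'} = P_{n+n'} if e + e' = 0, and T_{n,e}·T_{n',e'} = T_{n+n'+1/2, e+e'} + T_{n+n'−1/2, e+e'} if e + e' ≠ 0; T_{n,e}·P_{n'} = T_{n+n'+1,e} + 2·T_{n+n',e} + T_{n+n'−1,e}; P_n·P_{n'} = P_{n+n'+1} + 2·P_{n+n'} + P_{n+n'−1}; extended symmetrically so that the product is commutative. Then this multiplication is associative and commutative with multiplicative identity A_0, i.e. it makes R into a commutative unital ring. -/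
/-- Basis symbols of the representation ring of `gl(1|1)`: atypical irreducibles `A n`,
typical irreducibles `T n e` (with `e ≠ 0`), and projective indecomposables `P n`. -/
inductive GlSym : Type
  | A : ℝ → GlSym
  | T : ℝ → {e : ℝ // e ≠ 0} → GlSym
  | P : ℝ → GlSym

open GlSym in
/-- The tensor product of two basis symbols, as an element of the free abelian
group `GlSym →₀ ℤ` on the symbols. -/
noncomputable def glSymMul : GlSym → GlSym → (GlSym →₀ ℤ)
  | A n, A n' => Finsupp.single (A (n + n')) 1
  | A n, T n' e' => Finsupp.single (T (n + n') e') 1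
  | A n, P n' => Finsupp.single (P (n + n')) 1
  | T n e, A n' => Finsupp.single (T (n + n') e) 1
  | T n e, T n' e' =>
      if h : (e : ℝ) + (e' : ℝ) = 0 then Finsupp.single (P (n + n')) 1
      else Finsupp.single (T (n + n' + 1/2) ⟨(e : ℝ) + (e' : ℝ), h⟩) 1 +
        Finsupp.single (T (n + n' - 1/2) ⟨(e : ℝ) + (e' : ℝ), h⟩) 1
  | T n e, P n' =>
      Finsupp.single (T (n + n' + 1) e) 1 + 2 • Finsupp.single (T (n + n') e) 1 +
        Finsupp.single (T (n + n' - 1) e) 1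
  | P n, A n' => Finsupp.single (P (n + n')) 1
  | P n, T n' e' =>
      Finsupp.single (T (n + n' + 1) e') 1 + 2 • Finsupp.single (T (n + n') e') 1 +
        Finsupp.single (T (n + n' - 1) e') 1
  | P n, P n' =>
      Finsupp.single (P (n + n' + 1)) 1 + 2 • Finsupp.single (P (n + n')) 1 +
        Finsupp.single (P (n + n' - 1)) 1

/-- The bilinear extension of `glSymMul` to the free abelian group `GlSym →₀ ℤ`. -/
noncomputable def glMul (x y : GlSym →₀ ℤ) : GlSym →₀ ℤ :=
  x.sum fun s c => y.sum fun t d => (c * d) • glSymMul s t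

theorem glMul_add (x y z : GlSym →₀ ℤ) : glMul x (y + z) = glMul x y + glMul x z := by
  simp only [glMul, ← Finsupp.sum_add]
  refine Finsupp.sum_congr fun s _ => ?_
  exact Finsupp.sum_add_index' (by simp) (by simp [mul_add, add_smul])

theorem add_glMul (x y z : GlSym →₀ ℤ) : glMul (x + y) z = glMul x z + glMul y z := by
  refine Finsupp.sum_add_index' (by simp) fun s c d => ?_
  simp [← Finsupp.sum_add, add_mul, add_smul]

theorem glMul_zero (x : GlSym →₀ ℤ) : glMul x 0 = 0 := by simp [glMul]

theorem zero_glMul (x : GlSym →₀ ℤ) : glMul 0 x = 0 := by simp [glMul]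

theorem glMul_single_single (s t : GlSym) (c d : ℤ) :
    glMul (Finsupp.single s c) (Finsupp.single t d) = (c * d) • glSymMul s t := by
  simp [glMul]

theorem glSymMul_comm (s t : GlSym) : glSymMul s t = glSymMul t s := by
  cases s <;> cases t <;> simp only [glSymMul, add_comm]

theorem glMul_comm (x y : GlSym →₀ ℤ) : glMul x y = glMul y x := by
  rw [glMul, Finsupp.sum_comm]
  simp only [glMul, mul_comm, glSymMul_comm]

/-- `glMul` as a biadditive map. -/
noncomputable def glMulHom : (GlSym →₀ ℤ) →+ (GlSym →₀ ℤ) →+ (GlSym →₀ ℤ) where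
  toFun x := ⟨⟨glMul x, glMul_zero x⟩, glMul_add x⟩
  map_zero' := AddMonoidHom.ext zero_glMul
  map_add' x y := AddMonoidHom.ext (add_glMul x y)

theorem glMulHom_apply (x y : GlSym →₀ ℤ) : glMulHom x y = glMul x y := rfl

theorem zsmul_glMul (c : ℤ) (x y : GlSym →₀ ℤ) : glMul (c • x) y = c • glMul x y := by
  simp only [← glMulHom_apply, map_zsmul, AddMonoidHom.smul_apply]

theorem glMul_zsmul (c : ℤ) (x y : GlSym →₀ ℤ) : glMul x (c • y) = c • glMul x y := by
  simp only [← glMulHom_apply, map_zsmul]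

theorem nsmul_glMul (c : ℕ) (x y : GlSym →₀ ℤ) : glMul (c • x) y = c • glMul x y := by
  simp only [← glMulHom_apply, map_nsmul, AddMonoidHom.smul_apply]

theorem glMul_nsmul (c : ℕ) (x y : GlSym →₀ ℤ) : glMul x (c • y) = c • glMul x y := by
  simp only [← glMulHom_apply, map_nsmul]

theorem glMul_glSymMul_assoc (s t u : GlSym) :
    glMul (glSymMul s t) (Finsupp.single u 1) = glMul (Finsupp.single s 1) (glSymMul t u) := by
  rcases s with a | ⟨a, e, he⟩ | a <;> rcases t with b | ⟨b, f, hf⟩ | b <;>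
    rcases u with c | ⟨c, g, hg⟩ | c
  case T.T.T =>
    by_cases h₁ : e + f = 0 <;> by_cases h₂ : f + g = 0
    · obtain rfl : e = g := by linarith
      simp only [glSymMul, h₁, h₂, dite_true, glMul_single_single, mul_one, one_smul]
      ring_nf
    · have h₃ : e + (f + g) ≠ 0 := by rwa [← add_assoc, h₁, zero_add]
      simp only [glSymMul, h₁, h₂, h₃, dite_true, dite_false, glMul_add, glMul_single_single,
        mul_one, one_smul]
      have : e + (f + g) = g := by linarith
      simp only [this]
      ring_nf
      abel
    · have h₃ : e + f + g ≠ 0 := by rwa [add_assoc, h₂, add_zero]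
      simp only [glSymMul, h₁, h₂, h₃, dite_true, dite_false, add_glMul, glMul_single_single,
        mul_one, one_smul]
      have : e + f + g = e := by linarith
      simp only [this]
      ring_nf
      abel
    · by_cases h₃ : e + (f + g) = 0 <;>
      simp only [glSymMul, h₁, h₂, h₃, add_assoc e f g, dite_true, dite_false, add_glMul,
        glMul_add, glMul_single_single, mul_one, one_smul] <;> ring_nf
  all_goals
    simp only [glSymMul]
    try split_ifs
    all_goals
      simp only [glSymMul, add_glMul, glMul_add, nsmul_glMul, glMul_nsmul, glMul_single_single,
        mul_one, one_smul, *, dite_true, dite_false]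
      try ring_nf
      try abel

theorem glMul_assoc (x y z : GlSym →₀ ℤ) : glMul (glMul x y) z = glMul x (glMul y z) := by
  induction x using Finsupp.induction_linear with
  | zero => simp only [zero_glMul]
  | add x x' hx hx' => simp only [add_glMul, hx, hx']
  | single s a =>
  induction y using Finsupp.induction_linear with
  | zero => simp only [zero_glMul, glMul_zero]
  | add y y' hy hy' => simp only [add_glMul, glMul_add, hy, hy']
  | single t b =>
  induction z using Finsupp.induction_linear with
  | zero => simp only [glMul_zero]
  | add z z' hz hz' => simp only [glMul_add, hz, hz']
  | single u c =>
    have single_eq (v : GlSym) (d : ℤ) : Finsupp.single v d = d • Finsupp.single v 1 := by simp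
    rw [glMul_single_single, glMul_single_single, single_eq s, single_eq u]
    simp only [zsmul_glMul, glMul_zsmul, glMul_glSymMul_assoc, smul_smul]
    ring_nf

theorem glSymMul_A_zero (s : GlSym) : glSymMul (GlSym.A 0) s = Finsupp.single s 1 := by
  cases s <;> simp only [glSymMul, zero_add]

theorem one_glMul (x : GlSym →₀ ℤ) : glMul (Finsupp.single (GlSym.A 0) 1) x = x := by
  simp [glMul, glSymMul_A_zero]

/-- The tensor product rules of the finite-dimensional `gl(1|1)`-modules
make the free abelian group on the symbols `A n`, `T n e` (`e ≠ 0`), `P n` into a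
commutative, associative, unital ring with multiplicative identity `A 0`. -/
theorem gl11_representation_ring :
    (∀ x y z : GlSym →₀ ℤ, glMul (glMul x y) z = glMul x (glMul y z)) ∧
    (∀ x y : GlSym →₀ ℤ, glMul x y = glMul y x) ∧
    (∀ x y z : GlSym →₀ ℤ, glMul x (y + z) = glMul x y + glMul x z) ∧
    (∀ x y z : GlSym →₀ ℤ, glMul (x + y) z = glMul x z + glMul y z) ∧
    (∀ x : GlSym →₀ ℤ, glMul (Finsupp.single (GlSym.A 0) 1) x = x) ∧
    (∀ x : GlSym →₀ ℤ, glMul x (Finsupp.single (GlSym.A 0) 1) = x) := by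
  exact ⟨glMul_assoc, glMul_comm, glMul_add, add_glMul, one_glMul,
    fun x => (glMul_comm x _).trans (one_glMul x)⟩
end
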